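/- arXiv:2102.05258 — 2 statements merged into one kernel-verified Lean document; each statement's English description precedes it below -/
import Mathlib

section
/- In the locally free weight sharing pattern with offset r, for any two widths c ≤ c̃ with r + 1 ≤ c, and any admissible channel assignments I for width c and Ĩ for width c̃, the weight sharing degree satisfies (c − r − 1)/c ≤ d(I, Ĩ) ≤ 1, i.e., c_b/c ≤ d(I, Ĩ) ≤ 1 where c_b = c − r − 1 is the number of base channels of the smaller width. -/
/-- An admissible channel assignment of width `c` has exactly `c` channels. -/
theorem card_base_union_free {r c : ℕ} (hc : r + 1 ≤ c) {F : Finset ℕ}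
    (hF : F ⊆ Finset.Icc (c - r) (c + r)) (hFcard : F.card = r + 1) :
    (Finset.Icc 1 (c - r - 1) ∪ F).card = c := by
  have hdisj : Disjoint (Finset.Icc 1 (c - r - 1)) F := by
    rw [Finset.disjoint_left]
    intro x hx hxF
    have := Finset.mem_Icc.1 (hF hxF)
    have := Finset.mem_Icc.1 hx
    omega
  rw [Finset.card_union_of_disjoint hdisj, hFcard, Nat.card_Icc]
  omega

/-- In the locally free weight sharing pattern with offset `r`, for any two widths
`c ≤ c̃` with `r + 1 ≤ c` and any admissible channel assignments `I` for width `c` and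
`Ĩ` for width `c̃`, the weight sharing degree satisfies `(c − r − 1)/c ≤ d(I,Ĩ) ≤ 1`. -/
theorem locally_free_weight_sharing_degree_bounds
    (r c c' : ℕ) (hc : r + 1 ≤ c) (hcc' : c ≤ c')
    (F F' : Finset ℕ)
    (hF : F ⊆ Finset.Icc (c - r) (c + r)) (hFcard : F.card = r + 1)
    (hF' : F' ⊆ Finset.Icc (c' - r) (c' + r)) (hF'card : F'.card = r + 1)
    (I I' : Finset ℕ)
    (hI : I = Finset.Icc 1 (c - r - 1) ∪ F)
    (hI' : I' = Finset.Icc 1 (c' - r - 1) ∪ F') :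
    ((c - r - 1 : ℕ) : ℝ) / (c : ℝ) ≤ ((I ∩ I').card : ℝ) / (min I.card I'.card : ℝ) ∧
      ((I ∩ I').card : ℝ) / (min I.card I'.card : ℝ) ≤ 1 := by
  have hIcard : I.card = c := hI ▸ card_base_union_free hc hF hFcard
  have hI'card : I'.card = c' := hI' ▸ card_base_union_free (hc.trans hcc') hF' hF'card
  have hbase : Finset.Icc 1 (c - r - 1) ⊆ I ∩ I' := by
    rw [hI, hI']
    exact Finset.subset_inter Finset.subset_union_left
      ((Finset.Icc_subset_Icc_right (by omega)).trans Finset.subset_union_left)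
  have hlower : c - r - 1 ≤ (I ∩ I').card := by
    simpa using Finset.card_le_card hbase
  have hupper : (I ∩ I').card ≤ c :=
    hIcard ▸ Finset.card_le_card Finset.inter_subset_left
  rw [hIcard, hI'card, min_eq_left (Nat.cast_le.2 hcc')]
  exact ⟨by gcongr, div_le_one_of_le₀ (Nat.cast_le.2 hupper) (Nat.cast_nonneg c)⟩
end

section
/- In the locally free weight sharing pattern with offset r, if two widths c ≤ c̃ (both at least r+1) satisfy c + r < c̃ − r (i.e., the free zone of the smaller width lies entirely within the base channels of the larger width), then every admissible channel assignment I for width c is a subset of every admissible channel assignment Ĩ for width c̃, and hence d(I, Ĩ) = 1. -/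
/-- In the locally free weight sharing pattern with offset `r`, if two widths `c ≤ c̃`
(both at least `r+1`) satisfy `c + r < c̃ − r`, then every admissible channel assignment
`I` for width `c` is a subset of every admissible assignment `Ĩ` for width `c̃`, and
hence `d(I,Ĩ) = 1`. -/
theorem locally_free_far_widths_full_sharing
    (r c c' : ℕ) (hc : r + 1 ≤ c) (hc' : r + 1 ≤ c') (hcc' : c ≤ c')
    (hfar : c + r < c' - r)
    (F F' : Finset ℕ)
    (hF : F ⊆ Finset.Icc (c - r) (c + r)) (hFcard : F.card = r + 1)
    (hF' : F' ⊆ Finset.Icc (c' - r) (c' + r)) (hF'card : F'.card = r + 1)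
    (I I' : Finset ℕ)
    (hI : I = Finset.Icc 1 (c - r - 1) ∪ F)
    (hI' : I' = Finset.Icc 1 (c' - r - 1) ∪ F') :
    I ⊆ I' ∧ ((I ∩ I').card : ℝ) / (min I.card I'.card : ℝ) = 1 := by
  have hsub : I ⊆ I' := by
    intro x hx
    rw [hI, Finset.mem_union, Finset.mem_Icc] at hx
    rw [hI', Finset.mem_union, Finset.mem_Icc]
    left
    rcases hx with hx | hx
    · omega
    · have hxF := Finset.mem_Icc.mp (hF hx)
      omega
  have hpos : 0 < I.card := by
    have hFI : F.card ≤ I.card := by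
      rw [hI]
      exact Finset.card_le_card Finset.subset_union_right
    omega
  have hle : (I.card : ℝ) ≤ I'.card := by
    exact_mod_cast Finset.card_le_card hsub
  refine ⟨hsub, ?_⟩
  rw [Finset.inter_eq_left.mpr hsub, min_eq_left hle]
  exact div_self (by positivity)
end
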